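/- arXiv:2004.00854 — 3 statements merged into one kernel-verified Lean document; each statement's English description precedes it below -/
import Mathlib

section
/- Let B be a finite Blaschke product of degree m. Then for all nonnegative integers n, k: ∫_𝔻 B(z)^n · conj(B(z))^k · |B′(z)|² dV(z) = 0 if n ≠ k, and = π·m/(n+1) if n = k, where V is Lebesgue (area) measure on ℂ and 𝔻 is the open unit disc. -/
open MeasureTheory Metric Complex

noncomputable section

theorem setIntegral_ball_eq_setIntegral_polar (F : ℂ → ℂ) (R : ℝ) :
    ∫ z in ball (0 : ℂ) R, F z =
      ∫ p in Set.Icc ((0 : ℝ), -Real.pi) (R, Real.pi), p.1 * F (p.1 * exp (p.2 * I)) := by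
  have hae : (Set.Icc ((0 : ℝ), -Real.pi) (R, Real.pi) : Set (ℝ × ℝ)) =ᵐ[volume]
      (Set.Ioo 0 R ×ˢ Set.Ioo (-Real.pi) Real.pi : Set (ℝ × ℝ)) := by
    rw [← Set.Icc_prod_Icc]
    exact (Measure.set_prod_ae_eq Ioo_ae_eq_Icc Ioo_ae_eq_Icc).symm
  rw [setIntegral_congr_set hae, ← integral_indicator isOpen_ball.measurableSet,
    ← Complex.integral_comp_polarCoord_symm,
    ← integral_indicator (isOpen_Ioo.prod isOpen_Ioo).measurableSet,
    ← integral_indicator _root_.polarCoord.open_target.measurableSet]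
  congr 1 with p
  have hexp (x : ℝ) : (Real.cos x + Real.sin x * I : ℂ) = exp (x * I) := by
    rw [exp_mul_I]
    push_cast
    rfl
  simp only [_root_.polarCoord_target, Complex.polarCoord_symm_apply, hexp, Set.indicator,
    Set.mem_prod, Set.mem_Ioi, Set.mem_Ioo, mem_ball_zero_iff, norm_mul, norm_real,
    norm_exp_ofReal_mul_I, mul_one, Real.norm_eq_abs, real_smul]
  by_cases h0 : 0 < p.1
  · rw [abs_of_pos h0]
    split_ifs <;> simp_all
  · simp [h0]

/-- The complex form of Green's theorem on a disc. -/
theorem setIntegral_ball_mul_conj_deriv {f g : ℂ → ℂ} {U : Set ℂ} {R : ℝ} (hR : 0 ≤ R)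
    (hU : IsOpen U) (hRU : closedBall 0 R ⊆ U) (hf : DifferentiableOn ℂ f U)
    (hg : DifferentiableOn ℂ g U) :
    ∫ z in ball (0 : ℂ) R, f z * (starRingEnd ℂ) (deriv g z) =
      (2 * I)⁻¹ * ∮ z in C(0, R), f z * (starRingEnd ℂ) (g z) := by
  let E : ℝ × ℝ → ℂ := fun p => exp (p.2 * I)
  let c : ℝ × ℝ → ℂ := fun p => p.1 * E p
  let E' : ℝ × ℝ → ℝ × ℝ →L[ℝ] ℂ := fun p =>
    (E p * I) • (ofRealCLM.comp (ContinuousLinearMap.snd ℝ ℝ ℝ))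
  let c' : ℝ × ℝ → ℝ × ℝ →L[ℝ] ℂ := fun p =>
    (p.1 : ℂ) • E' p + E p • (ofRealCLM.comp (ContinuousLinearMap.fst ℝ ℝ ℝ))
  have hE (p) : HasFDerivAt E (E' p) p := by
    have h := ((ofRealCLM.hasFDerivAt.comp p
      (hasFDerivAt_snd (𝕜 := ℝ) (E := ℝ) (F := ℝ) (p := p))).mul_const I).cexp
    refine h.congr_fderiv ?_
    ext <;> simp [E', E]
  have hc (p) : HasFDerivAt c (c' p) p :=
    (ofRealCLM.hasFDerivAt.comp p (hasFDerivAt_fst (𝕜 := ℝ) (E := ℝ) (F := ℝ) (p := p))).mul (hE p)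
  have hcE : Continuous E := by fun_prop
  have hcc : Continuous c := by fun_prop
  have hcU : ∀ p ∈ Set.Icc ((0 : ℝ), -Real.pi) (R, Real.pi), c p ∈ U := by
    intro p hp
    apply hRU
    simp only [c, E, mem_closedBall_zero_iff, norm_mul, norm_real, norm_exp_ofReal_mul_I, mul_one,
      Real.norm_eq_abs]
    rw [abs_of_nonneg hp.1.1]
    exact hp.2.1
  have hcf : ContinuousOn (fun p => f (c p)) (Set.Icc ((0 : ℝ), -Real.pi) (R, Real.pi)) :=
    hf.continuousOn.comp hcc.continuousOn hcU
  have hcg : ContinuousOn (fun p => (starRingEnd ℂ) (g (c p)))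
      (Set.Icc ((0 : ℝ), -Real.pi) (R, Real.pi)) :=
    continuous_conj.comp_continuousOn (hg.continuousOn.comp hcc.continuousOn hcU)
  have hcg' : ContinuousOn (fun p => (starRingEnd ℂ) (deriv g (c p)))
      (Set.Icc ((0 : ℝ), -Real.pi) (R, Real.pi)) :=
    continuous_conj.comp_continuousOn
      ((hg.deriv hU).continuousOn.comp hcc.continuousOn hcU)
  let u' : ℝ × ℝ → ℝ × ℝ →L[ℝ] ℂ := fun p =>
    f (c p) • ((conjCLE : ℂ →L[ℝ] ℂ).comp (deriv g (c p) • c' p)) +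
      (starRingEnd ℂ) (g (c p)) • (deriv f (c p) • c' p)
  have hu : ∀ p ∈ Set.Icc ((0 : ℝ), -Real.pi) (R, Real.pi),
      HasFDerivAt (fun p => f (c p) * (starRingEnd ℂ) (g (c p))) (u' p) p := by
    intro p hp
    have hfp := ((hf.differentiableAt (hU.mem_nhds (hcU p hp))).hasDerivAt).comp_hasFDerivAt p (hc p)
    have hgp := ((hg.differentiableAt (hU.mem_nhds (hcU p hp))).hasDerivAt).comp_hasFDerivAt p (hc p)
    exact hfp.mul ((conjCLE : ℂ →L[ℝ] ℂ).hasFDerivAt.comp p hgp)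
  let P' : ℝ × ℝ → ℝ × ℝ →L[ℝ] ℂ := fun p =>
    (f (c p) * (starRingEnd ℂ) (g (c p))) • c' p + c p • u' p
  let Q' : ℝ × ℝ → ℝ × ℝ →L[ℝ] ℂ := fun p =>
    I • ((f (c p) * (starRingEnd ℂ) (g (c p))) • E' p + E p • u' p)
  have hmem {p : ℝ × ℝ} (hp : p ∈ Set.Ioo 0 R ×ˢ Set.Ioo (-Real.pi) Real.pi) :
      p ∈ Set.Icc ((0 : ℝ), -Real.pi) (R, Real.pi) := by
    rw [← Set.Icc_prod_Icc]
    exact Set.prod_mono Set.Ioo_subset_Icc_self Set.Ioo_subset_Icc_self hp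
  have key (p) : P' p (1, 0) + Q' p (0, 1) =
      2 * (p.1 * (f (c p) * (starRingEnd ℂ) (deriv g (c p)))) := by
    have hEE : E p * (starRingEnd ℂ) (E p) = 1 := by
      rw [mul_conj, normSq_eq_norm_sq]
      simp [E]
    simp [P', Q', u', c', E', c]
    linear_combination (-(p.1 * f (p.1 * E p) * (starRingEnd ℂ) (deriv g (p.1 * E p)) *
        E p * (starRingEnd ℂ) (E p)) +
      p.1 * (starRingEnd ℂ) (g (p.1 * E p)) * deriv f (p.1 * E p) * E p ^ 2 +
      f (p.1 * E p) * (starRingEnd ℂ) (g (p.1 * E p)) * E p) * I_sq +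
      2 * p.1 * f (p.1 * E p) * (starRingEnd ℂ) (deriv g (p.1 * E p)) * hEE
  have hdiv := integral_divergence_prod_Icc_of_hasFDerivAt_of_le
    (fun p => f (c p) * (starRingEnd ℂ) (g (c p)) * c p)
    (fun p => I * (f (c p) * (starRingEnd ℂ) (g (c p)) * E p)) P' Q' (0, -Real.pi) (R, Real.pi)
    ⟨hR, by simpa using Real.pi_pos.le⟩ ((hcf.mul hcg).mul hcc.continuousOn)
    (continuousOn_const.mul ((hcf.mul hcg).mul hcE.continuousOn))
    (fun p hp => (hu p (hmem hp)).mul (hc p))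
    (fun p hp => ((hu p (hmem hp)).mul (hE p)).const_mul I)
    (by
      simp_rw [key]
      refine ContinuousOn.integrableOn_Icc ?_
      exact continuousOn_const.mul
        ((by fun_prop : Continuous fun p : ℝ × ℝ => (p.1 : ℂ)).continuousOn.mul (hcf.mul hcg')))
  simp_rw [key] at hdiv
  rw [integral_const_mul] at hdiv
  rw [setIntegral_ball_eq_setIntegral_polar, eq_inv_mul_iff_mul_eq₀ (by simp), mul_comm 2 I,
    mul_assoc]
  refine (congrArg (I * ·) hdiv).trans ?_
  have hper : ∀ x : ℝ, E (x, Real.pi) = E (x, -Real.pi) := by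
    intro x
    simp only [E]
    push_cast
    rw [neg_mul, exp_neg, exp_pi_mul_I]
    norm_num
  simp only [c, hper, sub_self, zero_add, ofReal_zero, zero_mul, mul_zero,
    intervalIntegral.integral_zero, sub_zero]
  rw [circleIntegral, ← intervalIntegral.integral_const_mul]
  have hp := ((periodic_circleMap 0 R).comp
    fun z => I * (f z * (starRingEnd ℂ) (g z) * z)).intervalIntegral_add_eq (-Real.pi) 0
  rw [show -Real.pi + 2 * Real.pi = Real.pi by ring, zero_add] at hp
  convert hp using 1
  · simp [circleMap, E]
  · refine intervalIntegral.integral_congr fun x _ => ?_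
    simp
    ring

theorem setIntegral_ball_pow_mul_conj_pow_mul_norm_deriv_sq {B : ℂ → ℂ} {U : Set ℂ} {R : ℝ}
    (hR : 0 ≤ R) (hU : IsOpen U) (hRU : closedBall 0 R ⊆ U) (hB : DifferentiableOn ℂ B U)
    (hnorm : ∀ z ∈ sphere (0 : ℂ) R, ‖B z‖ = 1) (n k : ℕ) :
    (∫ z in ball (0 : ℂ) R,
        B z ^ n * (starRingEnd ℂ) (B z) ^ k * ((‖deriv B z‖ ^ 2 : ℝ) : ℂ)) =
      if n = k then (2 * I)⁻¹ * ((n + 1 : ℂ)⁻¹ * ∮ z in C(0, R), logDeriv B z) else 0 := by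
  have hk : (k + 1 : ℂ) ≠ 0 := Nat.cast_add_one_ne_zero k
  have hd : ∀ z ∈ U, HasDerivAt B (deriv B z) z := fun z hz =>
    (hB.differentiableAt (hU.mem_nhds hz)).hasDerivAt
  have hg : ∀ z ∈ U, HasDerivAt (fun z => B z ^ (k + 1) / (k + 1 : ℂ)) (B z ^ k * deriv B z) z := by
    intro z hz
    refine (((hd z hz).pow (k + 1)).div_const (k + 1 : ℂ)).congr_deriv ?_
    push_cast
    field_simp
  have hgreen := setIntegral_ball_mul_conj_deriv hR hU hRU
    ((hB.pow n).mul (hB.deriv hU))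
    (fun z hz => (hg z hz).differentiableAt.differentiableWithinAt)
  have hint : ∀ z ∈ ball (0 : ℂ) R,
      B z ^ n * (starRingEnd ℂ) (B z) ^ k * ((‖deriv B z‖ ^ 2 : ℝ) : ℂ) =
        (B ^ n * deriv B) z *
          (starRingEnd ℂ) (deriv (fun z => B z ^ (k + 1) / (k + 1 : ℂ)) z) := by
    intro z hz
    rw [(hg z (hRU (ball_subset_closedBall hz))).deriv, ← normSq_eq_norm_sq, ← mul_conj]
    simp only [Pi.mul_apply, Pi.pow_apply, map_mul, map_pow]
    ring
  rw [setIntegral_congr_fun isOpen_ball.measurableSet hint, hgreen]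
  have hne : ∀ z ∈ sphere (0 : ℂ) R, B z ≠ 0 := fun z hz h => by simpa [h] using hnorm z hz
  have hcirc : Set.EqOn (fun z => (B ^ n * deriv B) z *
      (starRingEnd ℂ) (B z ^ (k + 1) / (k + 1 : ℂ)))
      (fun z => (k + 1 : ℂ)⁻¹ * (B z ^ ((n : ℤ) - k - 1) * deriv B z)) (sphere 0 R) := by
    intro z hz
    have hconj : (starRingEnd ℂ) (B z) = (B z)⁻¹ := by
      rw [inv_def, normSq_eq_norm_sq, hnorm z hz]; simp
    have hz0 := hne z hz
    simp only [Pi.mul_apply, Pi.pow_apply, map_div₀, map_pow, hconj, map_add, map_natCast, map_one]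
    rw [sub_sub, zpow_sub₀ hz0]
    norm_cast
    rw [inv_pow]
    field_simp
  rw [circleIntegral.integral_congr hR hcirc, circleIntegral.integral_const_mul]
  split_ifs with hnk
  · subst hnk
    simp [logDeriv, div_eq_inv_mul]
  · have hnk' : ((n : ℤ) - k : ℂ) ≠ 0 := by
      simpa [sub_eq_zero] using hnk
    rw [circleIntegral.integral_eq_zero_of_hasDerivWithinAt
      (f := fun z => B z ^ ((n : ℤ) - k) / ((n : ℤ) - k : ℂ)) hR]
    · simp
    · intro z hz
      refine HasDerivAt.hasDerivWithinAt ?_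
      refine (((hasDerivAt_zpow ((n : ℤ) - k) (B z) (Or.inl (hne z hz))).comp z
        (hd z (hRU (sphere_subset_closedBall hz)))).div_const _).congr_deriv ?_
      push_cast at hnk' ⊢
      field_simp

theorem one_sub_conj_mul_ne_zero {a z : ℂ} (ha : ‖a‖ < 1) (hz : ‖z‖ ≤ 1) :
    1 - (starRingEnd ℂ) a * z ≠ 0 := by
  intro h
  have h1 : ‖(starRingEnd ℂ) a * z‖ = 1 := by rw [← sub_eq_zero.mp h, norm_one]
  rw [norm_mul, norm_conj] at h1
  nlinarith [norm_nonneg a, norm_nonneg z]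

theorem norm_blaschkeFactor_eq_one {a z : ℂ} (ha : ‖a‖ < 1) (hz : ‖z‖ = 1) :
    ‖(z - a) / (1 - (starRingEnd ℂ) a * z)‖ = 1 := by
  have h0 := one_sub_conj_mul_ne_zero ha hz.le
  have hzz : z * (starRingEnd ℂ) z = 1 := by
    rw [mul_conj, normSq_eq_norm_sq, hz]; simp
  have : 1 - (starRingEnd ℂ) a * z = z * (starRingEnd ℂ) (z - a) := by
    rw [map_sub]
    linear_combination -hzz
  rw [norm_div, div_eq_one_iff_eq (norm_ne_zero_iff.mpr h0), this, norm_mul, hz, norm_conj, one_mul]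

theorem logDeriv_blaschkeFactor {a z : ℂ} (hz : z - a ≠ 0)
    (h : 1 - (starRingEnd ℂ) a * z ≠ 0) :
    logDeriv (fun z => (z - a) / (1 - (starRingEnd ℂ) a * z)) z =
      (z - a)⁻¹ + (starRingEnd ℂ) a / (1 - (starRingEnd ℂ) a * z) := by
  have h1 : HasDerivAt (fun z : ℂ => z - a) 1 z := (hasDerivAt_id z).sub_const a
  have h2 : HasDerivAt (fun z : ℂ => 1 - (starRingEnd ℂ) a * z) (-(starRingEnd ℂ) a) z := by
    simpa using ((hasDerivAt_id z).const_mul ((starRingEnd ℂ) a)).const_sub 1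
  rw [logDeriv_div z hz h h1.differentiableAt h2.differentiableAt, logDeriv_apply, logDeriv_apply,
    h1.deriv, h2.deriv]
  ring

theorem circleIntegral_logDeriv_blaschke {ι : Type*} [Fintype ι] {lam : ℂ} (hlam : lam ≠ 0)
    {a : ι → ℂ} (ha : ∀ j, ‖a j‖ < 1) :
    (∮ z in C(0, 1), logDeriv
      (fun z => lam * ∏ j, (z - a j) / (1 - (starRingEnd ℂ) (a j) * z)) z) =
      Fintype.card ι * (2 * Real.pi * I) := by
  have hsub {z : ℂ} (hz : z ∈ sphere (0 : ℂ) 1) (j : ι) : z - a j ≠ 0 := by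
    intro h
    rw [sub_eq_zero] at h
    exact (ha j).ne (h ▸ mem_sphere_zero_iff_norm.mp hz)
  have hden (j : ι) : ∀ z ∈ closedBall (0 : ℂ) 1, 1 - (starRingEnd ℂ) (a j) * z ≠ 0 :=
    fun z hz => one_sub_conj_mul_ne_zero (ha j) (mem_closedBall_zero_iff.mp hz)
  have hsum : Set.EqOn
      (logDeriv (fun z => lam * ∏ j, (z - a j) / (1 - (starRingEnd ℂ) (a j) * z)))
      (fun z => ∑ j, ((z - a j)⁻¹ + (starRingEnd ℂ) (a j) / (1 - (starRingEnd ℂ) (a j) * z)))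
      (sphere 0 1) := by
    intro z hz
    have hz' := sphere_subset_closedBall hz
    rw [logDeriv_const_mul z lam hlam, logDeriv_prod]
    · exact Finset.sum_congr rfl fun j _ => logDeriv_blaschkeFactor (hsub hz j) (hden j z hz')
    · exact fun j _ => div_ne_zero (hsub hz j) (hden j z hz')
    · exact fun j _ => by
        have := hden j z hz'
        fun_prop (disch := assumption)
  have hcont₁ (j : ι) : ContinuousOn (fun z => (z - a j)⁻¹) (sphere (0 : ℂ) 1) :=
    (by fun_prop : ContinuousOn (fun z => z - a j) (sphere (0 : ℂ) 1)).inv₀ fun z hz => hsub hz j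
  have hdiff (j : ι) : ∀ z ∈ closedBall (0 : ℂ) 1, DifferentiableAt ℂ
      (fun z => (starRingEnd ℂ) (a j) / (1 - (starRingEnd ℂ) (a j) * z)) z := fun z hz => by
    have := hden j z hz
    fun_prop (disch := assumption)
  have hcont₂ (j : ι) : ContinuousOn
      (fun z => (starRingEnd ℂ) (a j) / (1 - (starRingEnd ℂ) (a j) * z)) (closedBall (0 : ℂ) 1) :=
    fun z hz => (hdiff j z hz).continuousAt.continuousWithinAt
  have hint₁ (j : ι) := (hcont₁ j).circleIntegrable zero_le_one
  have hint₂ (j : ι) := ((hcont₂ j).mono sphere_subset_closedBall).circleIntegrable zero_le_one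
  have hint (j : ι) (_ : j ∈ Finset.univ) : CircleIntegrable (fun z => (z - a j)⁻¹ +
      (starRingEnd ℂ) (a j) / (1 - (starRingEnd ℂ) (a j) * z)) 0 1 := (hint₁ j).add (hint₂ j)
  rw [circleIntegral.integral_congr zero_le_one hsum,
    circleIntegral.integral_fun_sum hint]
  have hterm (j : ι) : (∮ z in C(0, 1), ((z - a j)⁻¹ +
      (starRingEnd ℂ) (a j) / (1 - (starRingEnd ℂ) (a j) * z))) = 2 * Real.pi * I := by
    rw [circleIntegral.integral_add (hint₁ j) (hint₂ j),
      circleIntegral.integral_sub_inv_of_mem_ball (mem_ball_zero_iff.mpr (ha j)),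
      circleIntegral_eq_zero_of_differentiable_on_off_countable zero_le_one Set.countable_empty
        (hcont₂ j) fun z hz => hdiff j z (ball_subset_closedBall hz.1), add_zero]
  simp [hterm]

/-- for a finite Blaschke product `B` of degree `m`, and nonnegative integers
`n, k`, `∫_𝔻 Bⁿ·conj(B)^k·|B′|² dV` equals `0` if `n ≠ k` and `π·m/(n+1)` if `n = k`. -/
theorem stmt6 (m : ℕ) (lam : ℂ) (hlam : ‖lam‖ = 1) (a : Fin m → ℂ)
    (ha : ∀ j, ‖a j‖ < 1)
    (B : ℂ → ℂ)
    (hB : ∀ z : ℂ, B z = lam * ∏ j, (z - a j) / (1 - (starRingEnd ℂ) (a j) * z)) :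
    ∀ n k : ℕ,
      (∫ z in ball (0 : ℂ) 1,
          B z ^ n * (starRingEnd ℂ) (B z) ^ k * ((‖deriv B z‖ ^ 2 : ℝ) : ℂ))
        = if n = k then ((Real.pi * m / (n + 1) : ℝ) : ℂ) else 0 := by
  intro n k
  obtain rfl : B = _ := funext hB
  have hlam0 : lam ≠ 0 := norm_ne_zero_iff.mp (hlam ▸ one_ne_zero)
  have hU : IsOpen {z : ℂ | ∀ j, 1 - (starRingEnd ℂ) (a j) * z ≠ 0} := by
    simp only [Set.ofPred_forall]
    exact isOpen_iInter_of_finite fun j => isOpen_ne_fun (by fun_prop) continuous_const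
  rw [setIntegral_ball_pow_mul_conj_pow_mul_norm_deriv_sq zero_le_one hU
    (fun z hz j => one_sub_conj_mul_ne_zero (ha j) (mem_closedBall_zero_iff.mp hz))
    ?_ ?_, circleIntegral_logDeriv_blaschke hlam0 ha]
  · refine if_congr Iff.rfl ?_ rfl
    have : (n + 1 : ℂ) ≠ 0 := Nat.cast_add_one_ne_zero n
    push_cast
    rw [Fintype.card_fin]
    field_simp
  · refine DifferentiableOn.const_mul (DifferentiableOn.fun_finsetProd fun j _ => ?_) lam
    exact DifferentiableOn.div (by fun_prop) (by fun_prop) fun z hz => hz j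
  · intro z hz
    rw [norm_mul, hlam, one_mul, norm_prod]
    exact Finset.prod_eq_one fun j _ =>
      norm_blaschkeFactor_eq_one (ha j) (mem_sphere_zero_iff_norm.mp hz)
end
end

section
/- Let B₀ be a finite Blaschke product with trivial group of deck transformations, i.e. the only holomorphic bijection φ : 𝔻 → 𝔻 satisfying B₀∘φ = B₀ is the identity. Define B : 𝔻^d → 𝔻^d by B(z₁,…,z_d) = (B₀(z₁),…,B₀(z_d)). Then every biholomorphism Φ : 𝔻^d → 𝔻^d satisfying B∘Φ = B is the identity map. -/
open Metric Set Complex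

noncomputable section

/-- The unit polydisc `𝔻^d` in `ℂ^d`. -/
def polydisc (d : ℕ) : Set (Fin d → ℂ) := {z | ∀ i, z i ∈ ball (0 : ℂ) 1}

/-- A holomorphic function that is constant on a nontrivial preconnected subset of a preconnected
open set `U` is constant on `U`. -/
theorem eqOn_const_of_isPreconnected_of_nontrivial {U S : Set ℂ} {f : ℂ → ℂ} {c : ℂ}
    (hU : IsOpen U) (hUc : IsPreconnected U) (hf : DifferentiableOn ℂ f U) (hSU : S ⊆ U)
    (hS : IsPreconnected S) (hSn : S.Nontrivial) (hc : ∀ z ∈ S, f z = c) :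
    EqOn f (fun _ => c) U := by
  obtain ⟨x, hx⟩ := hSn.nonempty
  have hacc := hS.preperfect_of_nontrivial hSn x hx
  rw [accPt_iff_frequently_nhdsNE] at hacc
  exact (hf.analyticOnNhd hU).eqOn_of_preconnected_of_frequently_eq analyticOnNhd_const hUc
    (hSU hx) (hacc.mono hc)

/-- A finite Blaschke product is holomorphic on the unit disc. -/
theorem differentiableOn_blaschke {m : ℕ} (lam : ℂ) {a : Fin m → ℂ} (ha : ∀ j, ‖a j‖ < 1) :
    DifferentiableOn ℂ
      (fun z => lam * ∏ j, (z - a j) / (1 - (starRingEnd ℂ) (a j) * z)) (ball 0 1) := by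
  refine (DifferentiableOn.fun_finsetProd fun j _ => ?_).const_mul lam
  refine DifferentiableOn.div (by fun_prop) (by fun_prop) fun z hz h => ?_
  have hz1 : ‖z‖ < 1 := by simpa using hz
  have h1 : ‖(starRingEnd ℂ) (a j) * z‖ = 1 := by rw [← sub_eq_zero.mp h, norm_one]
  rw [norm_mul, RCLike.norm_conj] at h1
  nlinarith [norm_nonneg (a j), norm_nonneg z, ha j]

theorem convex_polydisc (d : ℕ) : Convex ℝ (polydisc d) := by
  intro x hx y hy s t hs ht hst i
  exact convex_ball (0 : ℂ) 1 (hx i) (hy i) hs ht hst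

/-- If `f` is holomorphic on the disc and not constant there, a continuous map `F` of the polydisc
into itself with `f (F z i) = f (z i)` has an `i`-th coordinate depending on `z i` only. -/
theorem apply_eq_apply_const_of_comp_eq {d : ℕ} {f : ℂ → ℂ}
    (hf : DifferentiableOn ℂ f (ball 0 1)) (hfc : ∀ c, ¬ EqOn f (fun _ => c) (ball 0 1))
    {F : (Fin d → ℂ) → (Fin d → ℂ)} (hF : ContinuousOn F (polydisc d))
    (hFm : MapsTo F (polydisc d) (polydisc d)) (i : Fin d)
    (hfF : ∀ z ∈ polydisc d, f (F z i) = f (z i)) {z : Fin d → ℂ} (hz : z ∈ polydisc d) :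
    F z i = F (fun _ => z i) i := by
  have hw : (fun _ => z i) ∈ polydisc d := fun _ => hz i
  have hpre : IsPreconnected ((fun y => F y i) '' segment ℝ z (fun _ => z i)) :=
    (convex_segment _ _).isPreconnected.image _
      ((continuousOn_pi.mp hF i).mono ((convex_polydisc d).segment_subset hz hw))
  by_contra hne
  refine hfc (f (z i)) (eqOn_const_of_isPreconnected_of_nontrivial isOpen_ball
    (convex_ball (0 : ℂ) 1).isPreconnected hf ?_ hpre
    ⟨_, mem_image_of_mem _ (left_mem_segment ℝ _ _), _,
      mem_image_of_mem _ (right_mem_segment ℝ _ _), hne⟩ ?_)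
  · rintro _ ⟨y, hy, rfl⟩
    exact hFm ((convex_polydisc d).segment_subset hz hw hy) i
  · rintro _ ⟨y, hy, rfl⟩
    have hyi : y i = z i := by
      obtain ⟨s, t, -, -, hst, rfl⟩ := hy
      simp [← add_mul, ← Complex.ofReal_add, hst]
    simp only [hfF y ((convex_polydisc d).segment_subset hz hw hy), hyi]

/-- if `B₀` is a finite Blaschke product with trivial group of deck
transformations (the only holomorphic bijection `φ : 𝔻 → 𝔻` with `B₀∘φ = B₀` is the
identity), and `B(z₁,…,z_d) = (B₀(z₁),…,B₀(z_d))`, then every biholomorphism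
`Φ : 𝔻^d → 𝔻^d` with `B∘Φ = B` is the identity. -/
theorem stmt9 (d : ℕ) (m : ℕ) (lam : ℂ) (hlam : ‖lam‖ = 1) (a : Fin m → ℂ)
    (ha : ∀ j, ‖a j‖ < 1)
    (B₀ : ℂ → ℂ)
    (hB₀ : ∀ z : ℂ, B₀ z = lam * ∏ j, (z - a j) / (1 - (starRingEnd ℂ) (a j) * z))
    (htrivial : ∀ φ : ℂ → ℂ, DifferentiableOn ℂ φ (ball (0 : ℂ) 1) →
      Set.BijOn φ (ball (0 : ℂ) 1) (ball (0 : ℂ) 1) →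
      (∀ z ∈ ball (0 : ℂ) 1, B₀ (φ z) = B₀ z) →
      ∀ z ∈ ball (0 : ℂ) 1, φ z = z) :
    ∀ Φ Ψ : (Fin d → ℂ) → (Fin d → ℂ),
      DifferentiableOn ℂ Φ (polydisc d) → Set.MapsTo Φ (polydisc d) (polydisc d) →
      DifferentiableOn ℂ Ψ (polydisc d) → Set.MapsTo Ψ (polydisc d) (polydisc d) →
      (∀ z ∈ polydisc d, Ψ (Φ z) = z) → (∀ z ∈ polydisc d, Φ (Ψ z) = z) →
      (∀ z ∈ polydisc d, (fun i => B₀ (Φ z i)) = fun i => B₀ (z i)) →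
      ∀ z ∈ polydisc d, Φ z = z := by
  intro Φ Ψ hΦ hΦm hΨ hΨm hΨΦ hΦΨ hB
  have hBd : DifferentiableOn ℂ B₀ (ball 0 1) := by
    rw [funext hB₀]
    exact differentiableOn_blaschke lam ha
  have hBc : ∀ c, ¬ EqOn B₀ (fun _ => c) (ball 0 1) := by
    intro c hc
    have hneg : MapsTo (fun z : ℂ => -z) (ball 0 1) (ball 0 1) := fun z hz => by simpa using hz
    have h := htrivial (fun z => -z) (by fun_prop)
      (InvOn.bijOn ⟨fun z _ => neg_neg z, fun z _ => neg_neg z⟩ hneg hneg) (fun z hz => by rw [hc hz, hc (hneg hz)])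
      (1 / 2) (by simp; norm_num)
    norm_num at h
  have hBΦ : ∀ z ∈ polydisc d, ∀ i, B₀ (Φ z i) = B₀ (z i) := fun z hz i => congrFun (hB z hz) i
  have hBΨ : ∀ z ∈ polydisc d, ∀ i, B₀ (Ψ z i) = B₀ (z i) := fun z hz i => by
    rw [← hBΦ _ (hΨm hz), hΦΨ z hz]
  have hΦi := fun i z (hz : z ∈ polydisc d) =>
    apply_eq_apply_const_of_comp_eq hBd hBc hΦ.continuousOn hΦm i (fun z hz => hBΦ z hz i) hz
  have hΨi := fun i z (hz : z ∈ polydisc d) =>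
    apply_eq_apply_const_of_comp_eq hBd hBc hΨ.continuousOn hΨm i (fun z hz => hBΨ z hz i) hz
  have hdiag : ∀ w ∈ ball (0 : ℂ) 1, (fun _ => w) ∈ polydisc d := fun w hw _ => hw
  intro z hz
  ext i
  rw [hΦi i z hz]
  refine htrivial (fun w => Φ (fun _ => w) i) ?_ ?_ (fun w hw => hBΦ _ (hdiag w hw) i) (z i) (hz i)
  · exact (differentiableOn_pi.mp hΦ i).comp (by fun_prop) hdiag
  · refine InvOn.bijOn (f' := fun w => Ψ (fun _ => w) i) ⟨fun w hw => ?_, fun w hw => ?_⟩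
      (fun w hw => hΦm (hdiag w hw) i) (fun w hw => hΨm (hdiag w hw) i)
    · exact (hΨi i _ (hΦm (hdiag w hw))).symm.trans (congrFun (hΨΦ _ (hdiag w hw)) i)
    · exact (hΦi i _ (hΨm (hdiag w hw))).symm.trans (congrFun (hΦΨ _ (hdiag w hw)) i)
end
end

section
/- Let m ≥ 2, let ω = e^{2πi/m}, and let Ω ⊆ ℂ^d be a domain invariant under the map ρ(z₁,z₂,…,z_d) = (ω·z₁, z₂,…,z_d). If F is holomorphic on Ω and satisfies F(ω·z₁, z₂,…,z_d) = ω^{m−1}·F(z₁,…,z_d) for all z ∈ Ω, then there exists a holomorphic function g on Ω such that F(z) = z₁^{m−1}·g(z) for all z ∈ Ω, and g is ρ-invariant: g(ω·z₁, z₂,…,z_d) = g(z₁,…,z_d) for all z ∈ Ω. -/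
open Set Complex

noncomputable section

open Metric Real MeasureTheory Filter Topology in
/-- Differentiation under the integral sign for averages of a holomorphic function over a
translated circle. -/
theorem differentiableAt_circleAverage_translate {ι : Type*} [Fintype ι]
    {Φ : (ι → ℂ) → ℂ} {U : Set (ι → ℂ)} (hU : IsOpen U) (hΦ : DifferentiableOn ℂ Φ U)
    (p e : ι → ℂ) (r : ℝ) (hp : ∀ θ : ℝ, p + circleMap 0 r θ • e ∈ U) :
    DifferentiableAt ℂ (fun z => circleAverage (fun ζ => Φ (z + ζ • e)) 0 r) p := by
  have hγ (z : ι → ℂ) : Continuous fun θ : ℝ => z + circleMap 0 r θ • e := by fun_prop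
  set K : Set (ι → ℂ) := (fun ζ : ℂ => p + ζ • e) '' sphere 0 |r| with hK_def
  have hK : IsCompact K := (isCompact_sphere _ _).image (by fun_prop)
  have hmemK (θ : ℝ) : p + circleMap 0 r θ • e ∈ K :=
    ⟨_, circleMap_mem_sphere' 0 r θ, rfl⟩
  have hKU : K ⊆ U := by
    rintro _ ⟨ζ, hζ, rfl⟩
    rw [← range_circleMap] at hζ
    obtain ⟨θ, rfl⟩ := hζ
    exact hp θ
  obtain ⟨δ, hδ, hδU⟩ := hK.exists_cthickening_subset_open hU hKU
  obtain ⟨C, hC⟩ := (hK.cthickening (r := δ)).exists_bound_of_continuousOn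
    (hΦ.continuousOn.mono hδU)
  have hnear : ∀ z ∈ ball p (δ / 2), ∀ θ : ℝ,
      ball (z + circleMap 0 r θ • e) (δ / 2) ⊆ cthickening δ K := by
    intro z hz θ w hw
    refine mem_cthickening_of_dist_le w _ δ K (hmemK θ) ?_
    have h1 : dist (z + circleMap 0 r θ • e) (p + circleMap 0 r θ • e) < δ / 2 := by
      rw [dist_add_right]; exact hz
    have h2 := dist_triangle w (z + circleMap 0 r θ • e) (p + circleMap 0 r θ • e)
    have h3 : dist w (z + circleMap 0 r θ • e) < δ / 2 := hw
    linarith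
  have hmemU : ∀ z ∈ ball p (δ / 2), ∀ θ : ℝ, z + circleMap 0 r θ • e ∈ U := fun z hz θ =>
    hδU (hnear z hz θ (mem_ball_self (by positivity)))
  have hcont : ∀ z ∈ ball p (δ / 2), Continuous fun θ : ℝ => Φ (z + circleMap 0 r θ • e) :=
    fun z hz => hΦ.continuousOn.comp_continuous (hγ z) (hmemU z hz)
  have hball : ball p (δ / 2) ∈ 𝓝 p := ball_mem_nhds p (by positivity)
  have key := intervalIntegral.hasFDerivAt_integral_of_dominated_of_fderiv_le
    (𝕜 := ℂ) (μ := volume) (a := 0) (b := 2 * π)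
    (F := fun z θ => Φ (z + circleMap 0 r θ • e))
    (F' := fun z θ => fderiv ℂ Φ (z + circleMap 0 r θ • e))
    (bound := fun _ => 2 * C / (δ / 2)) hball
    (by filter_upwards [hball] with z hz using (hcont z hz).aestronglyMeasurable)
    ((hcont p (mem_ball_self (by positivity))).intervalIntegrable _ _)
    (by
      borelize (ι → ℂ)
      exact ((measurable_fderiv ℂ Φ).comp (hγ p).measurable).aestronglyMeasurable)
    (by
      refine Eventually.of_forall fun θ _ z hz => ?_
      refine norm_fderiv_le_div_of_mapsTo_ball
        (hΦ.mono ((hnear z hz θ).trans hδU)) (fun w hw => ?_) (by positivity)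
      rw [mem_closedBall, dist_eq_norm]
      have h1 := hC w (hnear z hz θ hw)
      have h2 := hC _ (hnear z hz θ (mem_ball_self (by positivity)))
      linarith [norm_sub_le (Φ w) (Φ (z + circleMap 0 r θ • e))])
    (by simp)
    (by
      refine Eventually.of_forall fun θ _ z hz => ?_
      have h := (hΦ.differentiableAt (hU.mem_nhds (hmemU z hz θ))).hasFDerivAt
      exact (hasFDerivAt_comp_add_right (circleMap 0 r θ • e)).2 h)
  exact key.differentiableAt.const_smul _

open Metric Real Filter Topology in
/-- A holomorphic function vanishing on a coordinate hyperplane is divisible by that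
coordinate. -/
theorem exists_differentiableOn_eq_coord_mul {ι : Type*} [Fintype ι] [DecidableEq ι] (i : ι)
    {Ω : Set (ι → ℂ)} (hΩ : IsOpen Ω) {F : (ι → ℂ) → ℂ} (hF : DifferentiableOn ℂ F Ω)
    (hF0 : ∀ z ∈ Ω, z i = 0 → F z = 0) :
    ∃ G : (ι → ℂ) → ℂ, DifferentiableOn ℂ G Ω ∧ ∀ z ∈ Ω, F z = z i * G z := by
  wlog hF0' : ∀ z, z i = 0 → F z = 0 generalizing F
  · have heq : ∀ z ∈ Ω, (if z i = 0 then 0 else F z) = F z := fun z hz => by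
      split_ifs with h
      exacts [(hF0 z hz h).symm, rfl]
    obtain ⟨G, hG, hFG⟩ := this (F := fun z => if z i = 0 then 0 else F z) (hF.congr heq)
      (fun z _ h => if_pos h) (fun z h => if_pos h)
    exact ⟨G, hG, fun z hz => (heq z hz).symm.trans (hFG z hz)⟩
  set G : (ι → ℂ) → ℂ := fun z => dslope (fun t => F (Function.update z i t)) 0 (z i) with hG_def
  have hdiv (z : ι → ℂ) (t : ℂ) (ht : t ≠ 0) :
      dslope (fun t => F (Function.update z i t)) 0 t
        = F (Function.update z i t) / (Function.update z i t i) := by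
    rw [dslope_of_ne _ ht, slope_def_field, hF0' (Function.update z i 0) (by simp)]
    simp
  have hGne (z : ι → ℂ) (hz : z i ≠ 0) : G z = F z / z i := by
    simpa using hdiv z (z i) hz
  have hcoord : IsOpen {z : ι → ℂ | z i ≠ 0} :=
    isOpen_ne.preimage (continuous_apply i)
  have hquot : DifferentiableOn ℂ (fun z => F z / z i) (Ω ∩ {z | z i ≠ 0}) := by
    simp only [div_eq_mul_inv]
    exact (hF.mono inter_subset_left).fun_mul
      ((differentiable_apply (𝕜 := ℂ) i).differentiableOn.fun_inv fun _ hz => hz.2)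
  refine ⟨G, fun p hp => DifferentiableAt.differentiableWithinAt ?_, fun z hz => ?_⟩
  · by_cases hpi : p i = 0
    · obtain ⟨R, hR, hRΩ⟩ := Metric.isOpen_iff.1 hΩ p hp
      have hupd : ∀ z ∈ ball p R, ∀ t ∈ ball (0 : ℂ) R, Function.update z i t ∈ Ω := by
        intro z hz t ht
        refine hRΩ ?_
        rw [mem_ball, dist_pi_lt_iff hR] at hz ⊢
        intro j
        rcases eq_or_ne j i with rfl | hj
        · simpa [hpi] using ht
        · simpa [hj] using hz j
      have hadd (z : ι → ℂ) (ζ : ℂ) :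
          z + ζ • Pi.single i (1 : ℂ) = Function.update z i (z i + ζ) := by
        ext j
        rcases eq_or_ne j i with rfl | hj
        · simp
        · simp [hj]
      have hr : 0 < R / 2 := by positivity
      have hdiff := differentiableAt_circleAverage_translate
        (hΩ.inter hcoord) hquot p (Pi.single i 1) (R / 2) (fun θ => by
          rw [hadd]
          refine ⟨hupd p (mem_ball_self hR) _ ?_, ?_⟩
          · simpa [hpi, abs_of_pos hr] using half_lt_self hR
          · simp [hpi, hR.ne'])
      refine hdiff.congr_of_eventuallyEq ?_
      filter_upwards [ball_mem_nhds p (show 0 < R / 4 by positivity)] with z hz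
      have hzR : z ∈ ball p R := ball_subset_ball (by linarith) hz
      have hzi : ‖z i‖ < R / 4 := by
        have := (dist_pi_lt_iff (by positivity)).1 (mem_ball.1 hz) i
        simpa [hpi] using this
      have hslice : DifferentiableOn ℂ (fun t => F (Function.update z i t)) (ball 0 R) :=
        hF.comp (fun t _ => (hasFDerivAt_update z t).differentiableAt.differentiableWithinAt)
          (hupd z hzR)
      have hds : DifferentiableOn ℂ (dslope (fun t => F (Function.update z i t)) 0) (ball 0 R) :=
        (Complex.differentiableOn_dslope (ball_mem_nhds 0 hR)).2 hslice
      have hsub : closedBall (z i) |R / 2| ⊆ ball 0 R := by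
        rw [abs_of_pos hr]
        refine closedBall_subset_ball' ?_
        rw [dist_zero_right]; linarith
      have hmean := (hds.mono hsub).diffContOnCl_ball subset_rfl |>.circleAverage
      rw [hG_def]
      refine hmean.symm.trans ?_
      rw [circleAverage_def, circleAverage_def]
      congr 2
      ext θ
      have hc : circleMap (z i) (R / 2) θ = z i + circleMap 0 (R / 2) θ := by simp [circleMap]
      rw [hc, hadd, hdiv]
      intro h0
      have h1 : ‖circleMap 0 (R / 2) θ‖ = ‖z i‖ := by
        rw [eq_neg_of_add_eq_zero_right h0, norm_neg]
      rw [norm_circleMap_zero, abs_of_pos hr] at h1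
      linarith
    · have hmem : Ω ∩ {z | z i ≠ 0} ∈ 𝓝 p := (hΩ.inter hcoord).mem_nhds ⟨hp, hpi⟩
      refine (hquot.differentiableAt hmem).congr_of_eventuallyEq ?_
      filter_upwards [hmem] with z hz using hGne z hz.2
  · by_cases hzi : z i = 0
    · simp [hzi, hF0' z hzi]
    · rw [hGne z hzi, mul_div_cancel₀ _ hzi]

/-- A holomorphic function on which multiplication of the `i`-th coordinate by `ω` acts as
multiplication by `ω ^ k` is divisible by the `k`-th power of that coordinate, with invariant
quotient, provided `ω` satisfies no relation `ω ^ j = 1` for `1 ≤ j ≤ k`. -/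
theorem exists_differentiableOn_eq_coord_pow_mul {ι : Type*} [Fintype ι] [DecidableEq ι] (i : ι)
    {Ω : Set (ι → ℂ)} (hΩ : IsOpen Ω) {ω : ℂ} (hω : ω ≠ 0)
    (hρ : ∀ z ∈ Ω, Function.update z i (ω * z i) ∈ Ω) (k : ℕ)
    (hk : ∀ j, 1 ≤ j → j ≤ k → ω ^ j ≠ 1)
    {F : (ι → ℂ) → ℂ} (hF : DifferentiableOn ℂ F Ω)
    (hFeq : ∀ z ∈ Ω, F (Function.update z i (ω * z i)) = ω ^ k * F z) :
    ∃ g : (ι → ℂ) → ℂ, DifferentiableOn ℂ g Ω ∧ (∀ z ∈ Ω, F z = z i ^ k * g z) ∧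
      ∀ z ∈ Ω, g (Function.update z i (ω * z i)) = g z := by
  induction k generalizing F with
  | zero => exact ⟨F, hF, by simp, by simpa using hFeq⟩
  | succ k ih =>
    obtain ⟨G, hG, hFG⟩ := exists_differentiableOn_eq_coord_mul i hΩ hF fun z hz hzi => by
      have h := hFeq z hz
      have hfix : Function.update z i (ω * z i) = z := by
        rw [hzi, mul_zero, ← hzi, Function.update_eq_self]
      rw [hfix] at h
      have h1 : (ω ^ (k + 1) - 1) * F z = 0 := by linear_combination -h
      exact (mul_eq_zero.1 h1).resolve_left (sub_ne_zero.2 (hk (k + 1) (by omega) le_rfl))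
    have hdense : Dense {z : ι → ℂ | z i ≠ 0} :=
      (dense_compl_singleton (0 : ℂ)).preimage (isOpenMap_eval i)
    have hcont : Continuous fun z : ι → ℂ => Function.update z i (ω * z i) := by fun_prop
    have hGeq : EqOn (fun z => G (Function.update z i (ω * z i))) (fun z => ω ^ k * G z) Ω := by
      refine EqOn.of_subset_closure (s := Ω ∩ {z | z i ≠ 0}) ?_
        (hG.continuousOn.comp hcont.continuousOn hρ) (hG.continuousOn.const_mul _)
        inter_subset_left (hdense.open_subset_closure_inter hΩ)
      rintro z ⟨hz, hzi⟩
      have h := hFeq z hz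
      rw [hFG _ (hρ z hz), hFG z hz, Function.update_self] at h
      refine mul_left_cancel₀ (mul_ne_zero hω hzi) ?_
      linear_combination h
    obtain ⟨g, hg, hGg, hgρ⟩ := ih (fun j h1 h2 => hk j h1 (by omega)) hG hGeq
    exact ⟨g, hg, fun z hz => by rw [hFG z hz, hGg z hz]; ring, hgρ⟩

/-- let `ω = e^{2πi/m}` (`m ≥ 2`) and let `Ω ⊆ ℂ^d` be a domain invariant
under `ρ(z₁,z₂,…,z_d) = (ω·z₁,z₂,…,z_d)`.  If `F` is holomorphic on `Ω` and
`F∘ρ = ω^{m−1}·F` on `Ω`, then `F = z₁^{m−1}·g` for some holomorphic `g` on `Ω` which is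
`ρ`-invariant. -/
theorem stmt16 (d : ℕ) (hd : 0 < d) (m : ℕ) (hm : 2 ≤ m)
    (ω : ℂ) (hω : ω = Complex.exp (2 * Real.pi * Complex.I / m))
    (ρ : (Fin d → ℂ) → (Fin d → ℂ))
    (hρ : ∀ z : Fin d → ℂ, ρ z = Function.update z ⟨0, hd⟩ (ω * z ⟨0, hd⟩))
    (Ω : Set (Fin d → ℂ)) (hΩo : IsOpen Ω) (hΩc : IsConnected Ω)
    (hΩinv : ρ '' Ω = Ω)
    (F : (Fin d → ℂ) → ℂ) (hF : DifferentiableOn ℂ F Ω)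
    (hFeq : ∀ z ∈ Ω, F (ρ z) = ω ^ (m - 1) * F z) :
    ∃ g : (Fin d → ℂ) → ℂ, DifferentiableOn ℂ g Ω ∧
      (∀ z ∈ Ω, F z = z ⟨0, hd⟩ ^ (m - 1) * g z) ∧
      (∀ z ∈ Ω, g (ρ z) = g z) := by
  have hprim : IsPrimitiveRoot ω m := hω ▸ Complex.isPrimitiveRoot_exp m (by omega)
  have hmaps : ∀ z ∈ Ω, Function.update z ⟨0, hd⟩ (ω * z ⟨0, hd⟩) ∈ Ω := fun z hz => by
    rw [← hρ, ← hΩinv]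
    exact mem_image_of_mem ρ hz
  simp only [hρ] at hFeq ⊢
  exact exists_differentiableOn_eq_coord_pow_mul ⟨0, hd⟩ hΩo (hprim.ne_zero (by omega)) hmaps
    (m - 1) (fun j h1 h2 => hprim.pow_ne_one_of_pos_of_lt (by omega) (by omega)) hF hFeq
end
end
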